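/- arXiv:math/9907064 — 3 statements merged into one kernel-verified Lean document; each statement's English description precedes it below -/
import Mathlib

section
/- Every multiset of four digits has at most 11 prime 4-digit arrangements, and exactly two multisets attain this maximum, namely {1,2,3,7} and {1,2,7,9}: each has exactly 11 prime arrangements among its 4-digit arrangements. -/
/-- The number of prime `N`-digit arrangements of the digit multiset `S`. -/
def primeArrCount (N : ℕ) (S : Multiset ℕ) : ℕ :=
  ((Finset.Ico (10 ^ (N - 1)) (10 ^ N)).filter
    (fun m => (Nat.digits 10 m : Multiset ℕ) = S ∧ Nat.Prime m)).card

namespace PrimeArr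

/-- Trial division by the primes below 100. -/
def trial (m : ℕ) : Bool :=
  [2, 3, 5, 7, 11, 13, 17, 19, 23, 29, 31, 37, 41, 43, 47, 53, 59, 61, 67, 71, 73, 79,
    83, 89, 97].all (fun p => !(Nat.beq (m % p) 0))

/-- Value of a little-endian digit list. -/
def val : List ℕ → ℕ
  | [] => 0
  | x :: xs => x + 10 * val xs

/-- Number of distinct entries. -/
def uc : List ℕ → ℕ
  | [] => 0
  | x :: xs => bif xs.any (fun y => Nat.beq x y) then uc xs else uc xs + 1

/-- Candidate primes among the arrangements. -/
def cands (l : List ℕ) : List ℕ :=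
  (l.permutations'.map val).filter (fun m => Nat.ble 1000 m && trial m)

/-- The test for one sorted digit list. -/
def test (a b c d : ℕ) : Bool :=
  Nat.ble (uc (cands [a, b, c, d])) 10 ||
    (Nat.ble (uc (cands [a, b, c, d])) 11 &&
      (Nat.beq a 1 && Nat.beq b 2 &&
        ((Nat.beq c 3 && Nat.beq d 7) || (Nat.beq c 7 && Nat.beq d 9))))

def checkAll : Bool :=
  (List.range 10).all fun a => (List.range 10).all fun b => !(Nat.ble a b) ||
    (List.range 10).all fun c => !(Nat.ble b c) ||
      (List.range 10).all fun d => !(Nat.ble c d) || test a b c d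

set_option maxRecDepth 100000 in
theorem checkAll_eq : checkAll = true := by decide +kernel

theorem trial_of_prime {m : ℕ} (hm : 1000 ≤ m) (hp : m.Prime) : trial m = true := by
  unfold trial
  rw [List.all_eq_true]
  intro p hpm
  have h2 : 2 ≤ p ∧ p < 100 := by
    revert p
    decide
  have : m % p ≠ 0 := by
    intro h
    rcases (Nat.dvd_prime hp).1 (Nat.dvd_of_mod_eq_zero h) with h | h <;> omega
  cases hb : Nat.beq (m % p) 0
  · rfl
  · exact absurd (Nat.eq_of_beq_eq_true hb) this

theorem card_eq_uc (l : List ℕ) : l.toFinset.card = uc l := by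
  induction l with
  | nil => rfl
  | cons x xs ih =>
    have h : (xs.any (fun y => Nat.beq x y)) = true ↔ x ∈ xs := by
      simp [List.any_eq_true]
    rw [List.toFinset_cons, uc]
    by_cases hx : x ∈ xs
    · rw [h.2 hx, cond_true, Finset.insert_eq_of_mem (List.mem_toFinset.2 hx), ih]
    · rw [Bool.eq_false_iff.2 (fun t => hx (h.1 t)), cond_false,
        Finset.card_insert_of_notMem (fun t => hx (List.mem_toFinset.1 t)), ih]

theorem val_eq (l : List ℕ) : val l = Nat.ofDigits 10 l := by
  induction l with
  | nil => rfl
  | cons x xs ih => rw [val, ih, Nat.ofDigits_cons]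

theorem count_le (l : List ℕ) : primeArrCount 4 (l : Multiset ℕ) ≤ uc (cands l) := by
  rw [← card_eq_uc]
  apply Finset.card_le_card
  intro m hm
  simp only [Finset.mem_filter, Finset.mem_Ico] at hm
  obtain ⟨⟨h1, -⟩, h2, h3⟩ := hm
  have h1 : 1000 ≤ m := by simpa using h1
  rw [List.mem_toFinset, cands, List.mem_filter]
  refine ⟨List.mem_map.2 ⟨Nat.digits 10 m, List.mem_permutations'.2 (Multiset.coe_eq_coe.1 h2), ?_⟩, ?_⟩
  · rw [val_eq, Nat.ofDigits_digits]
  · rw [trial_of_prime h1 h3, Nat.ble_eq_true_of_le h1]; rfl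

theorem main (S : Multiset ℕ) (hc : Multiset.card S = 4) (hd : ∀ d ∈ S, d ≤ 9) :
    primeArrCount 4 S ≤ 10 ∨
      (primeArrCount 4 S ≤ 11 ∧ (S = {1, 2, 3, 7} ∨ S = {1, 2, 7, 9})) := by
  have hs : ((S.sort (· ≤ ·) : List ℕ) : Multiset ℕ) = S := Multiset.sort_eq S (· ≤ ·)
  have hsort := Multiset.pairwise_sort S (· ≤ ·)
  generalize S.sort (· ≤ ·) = l at hs hsort
  subst hs
  obtain ⟨a, b, c, d, rfl⟩ : ∃ a b c d, l = [a, b, c, d] := List.length_eq_four.1 (by simpa using hc)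
  simp at hd hsort
  have hle := count_le [a, b, c, d]
  have H := checkAll_eq
  simp only [checkAll, List.all_eq_true, List.mem_range, Bool.or_eq_true, Bool.not_eq_true',
    Bool.eq_false_iff, ne_eq, Nat.ble_eq] at H
  have h1 := ((H a (by omega) b (by omega)).resolve_left (by omega) c (by omega)).resolve_left
    (by omega) d (by omega) |>.resolve_left (by omega)
  simp only [test, Bool.or_eq_true, Bool.and_eq_true, Nat.ble_eq, Nat.beq_eq] at h1
  rcases h1 with h | ⟨h, ⟨rfl, rfl⟩, ⟨rfl, rfl⟩ | ⟨rfl, rfl⟩⟩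
  · left; omega
  · right; exact ⟨by omega, Or.inl rfl⟩
  · right; exact ⟨by omega, Or.inr rfl⟩

theorem le_count (S : Multiset ℕ) (T : Finset ℕ) (hT : T.card = 11)
    (h : ∀ m ∈ T, (1000 ≤ m ∧ m < 10000) ∧ (Nat.digits 10 m : Multiset ℕ) = S ∧ Nat.Prime m) :
    11 ≤ primeArrCount 4 S := by
  rw [← hT]
  apply Finset.card_le_card
  intro m hm
  simpa using h m hm

end PrimeArr


/-- Every multiset of four digits has at most 11 prime 4-digit arrangements,
and exactly the two multisets `{1,2,3,7}` and `{1,2,7,9}` attain this maximum. -/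
theorem stmt_13 :
    (∀ S : Multiset ℕ, Multiset.card S = 4 → (∀ d ∈ S, d ≤ 9) →
      primeArrCount 4 S ≤ 11) ∧
    primeArrCount 4 {1, 2, 3, 7} = 11 ∧
    primeArrCount 4 {1, 2, 7, 9} = 11 ∧
    (∀ S : Multiset ℕ, Multiset.card S = 4 → (∀ d ∈ S, d ≤ 9) →
      primeArrCount 4 S = 11 → S = {1, 2, 3, 7} ∨ S = {1, 2, 7, 9}) := by
  have e1 : 11 ≤ primeArrCount 4 {1, 2, 3, 7} := by
    refine PrimeArr.le_count _ {1237, 1327, 1723, 2137, 2371, 2713, 2731, 3217, 3271, 7213, 7321} (by decide) ?_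
    intro m hm
    simp only [Finset.mem_insert, Finset.mem_singleton] at hm
    rcases hm with rfl | rfl | rfl | rfl | rfl | rfl | rfl | rfl | rfl | rfl | rfl <;>
      exact ⟨by norm_num, by norm_num; decide, by norm_num⟩
  have e2 : 11 ≤ primeArrCount 4 {1, 2, 7, 9} := by
    refine PrimeArr.le_count _ {1279, 1297, 2179, 2719, 2791, 2917, 2971, 7129, 7219, 9127, 9721} (by decide) ?_
    intro m hm
    simp only [Finset.mem_insert, Finset.mem_singleton] at hm
    rcases hm with rfl | rfl | rfl | rfl | rfl | rfl | rfl | rfl | rfl | rfl | rfl <;>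
      exact ⟨by norm_num, by norm_num; decide, by norm_num⟩
  have ub : ∀ S : Multiset ℕ, Multiset.card S = 4 → (∀ d ∈ S, d ≤ 9) →
      primeArrCount 4 S ≤ 11 := by
    intro S hc hd
    rcases PrimeArr.main S hc hd with h | h
    · omega
    · exact h.1
  refine ⟨ub, le_antisymm (ub _ (by decide) (by decide)) e1,
    le_antisymm (ub _ (by decide) (by decide)) e2, ?_⟩
  intro S hc hd he
  rcases PrimeArr.main S hc hd with h | h
  · omega
  · exact h.2
end

section
/- Among multisets of four digits all lying in {1, 3, 7, 9}, the maximum number of prime 4-digit arrangements is 8, attained by the multiset {1,1,3,9} (which has exactly 8 prime arrangements among its 12 arrangements); the multiset {1,3,7,9} has exactly 7 prime arrangements among its 24 arrangements. -/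
/-- The number of `N`-digit arrangements of the digit multiset `S`. -/
def arrCount (N : ℕ) (S : Multiset ℕ) : ℕ :=
  ((Finset.Ico (10 ^ (N - 1)) (10 ^ N)).filter
    (fun m => (Nat.digits 10 m : Multiset ℕ) = S)).card

/-- Trial division by the primes below 100. -/
def isP (p : ℕ) : Bool :=
  [2, 3, 5, 7, 11, 13, 17, 19, 23, 29, 31, 37, 41, 43, 47, 53, 59, 61, 67, 71, 73, 79, 83, 89,
    97].all (fun q => p % q != 0)

theorem isP_iff (p : ℕ) (h1 : 1000 ≤ p) (h2 : p < 10000) : p.Prime ↔ isP p = true := by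
  unfold isP
  rw [List.all_eq_true]
  constructor
  · intro hp q hq
    have hq' : q ≠ 1 ∧ q < 100 := by
      revert q
      decide
    simp only [bne_iff_ne, ne_eq]
    intro h
    rcases (Nat.dvd_prime hp).1 (Nat.dvd_of_mod_eq_zero h) with h | h <;> omega
  · intro h
    by_contra hp
    have hle := Nat.minFac_sq_le_self (by omega) hp
    have hlt : p.minFac < 100 := by nlinarith
    have hpr := Nat.minFac_prime (n := p) (by omega)
    have hd := Nat.minFac_dvd p
    have key : ∀ q < 100, q.Prime → q ∈ [2, 3, 5, 7, 11, 13, 17, 19, 23, 29, 31, 37, 41, 43, 47,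
        53, 59, 61, 67, 71, 73, 79, 83, 89, 97] := by
      intro q hq hqp
      interval_cases q <;> first | (simp; done) | (exfalso; revert hqp; norm_num; done)
    have := h _ (key _ hlt hpr)
    simp only [bne_iff_ne, ne_eq] at this
    exact this (Nat.mod_eq_zero_of_dvd hd)

/-- All numbers whose digits are an arrangement of `l`. -/
def arrs (l : List ℕ) : List ℕ := l.permutations'.map (Nat.ofDigits 10)

theorem mem_arrs (l : List ℕ) (hl : l.length = 4) (hd : ∀ d ∈ l, 0 < d ∧ d < 10) (m : ℕ) :
    (m ∈ Finset.Ico (10 ^ (4 - 1)) (10 ^ 4) ∧ (Nat.digits 10 m : Multiset ℕ) = (l : Multiset ℕ))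
      ↔ m ∈ arrs l := by
  unfold arrs
  simp only [List.mem_map, List.mem_permutations', Multiset.coe_eq_coe, Finset.mem_Ico]
  constructor
  · rintro ⟨_, h⟩
    exact ⟨_, h, Nat.ofDigits_digits 10 m⟩
  · rintro ⟨t, ht, rfl⟩
    have hlen : t.length = 4 := ht.length_eq.trans hl
    have hdt : ∀ d ∈ t, 0 < d ∧ d < 10 := fun d h => hd d (ht.mem_iff.1 h)
    refine ⟨?_, ?_⟩
    · match t, hlen with
      | [a, b, c, d], _ =>
        simp only [List.mem_cons, List.not_mem_nil, or_false, forall_eq_or_imp, forall_eq] at hdt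
        simp only [Nat.ofDigits_cons, Nat.ofDigits_nil]
        norm_num
        omega
    · rw [Nat.digits_ofDigits 10 (by norm_num) t (fun d h => (hdt d h).2)
        (fun h => (hdt _ (List.getLast_mem h)).1.ne')]
      exact ht

theorem arrCount_eq (l : List ℕ) (hl : l.length = 4) (hd : ∀ d ∈ l, 0 < d ∧ d < 10) :
    arrCount 4 (l : Multiset ℕ) = (arrs l).dedup.length := by
  unfold arrCount
  rw [← List.card_toFinset]
  congr 1
  ext m
  rw [Finset.mem_filter, mem_arrs l hl hd, List.mem_toFinset]

theorem primeArrCount_eq (l : List ℕ) (hl : l.length = 4) (hd : ∀ d ∈ l, 0 < d ∧ d < 10) :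
    primeArrCount 4 (l : Multiset ℕ) = ((arrs l).filter isP).dedup.length := by
  unfold primeArrCount
  rw [← List.card_toFinset]
  congr 1
  ext m
  rw [Finset.mem_filter, ← and_assoc, mem_arrs l hl hd, List.mem_toFinset, List.mem_filter]
  refine and_congr_right fun h => ?_
  have := (Finset.mem_Ico.1 ((mem_arrs l hl hd m).2 h).1)
  exact isP_iff m (by norm_num at this; omega) (by norm_num at this; omega)

theorem bound_all : ∀ a ∈ [1, 3, 7, 9], ∀ b ∈ [1, 3, 7, 9], ∀ c ∈ [1, 3, 7, 9],
    ∀ d ∈ [1, 3, 7, 9], ((arrs [a, b, c, d]).filter isP).dedup.length ≤ 8 := by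
  decide +kernel

/-- Among multisets of four digits all lying in {1, 3, 7, 9}, the maximum number
of prime 4-digit arrangements is 8, attained by `{1,1,3,9}` (8 primes among its
12 arrangements); `{1,3,7,9}` has exactly 7 primes among its 24 arrangements. -/
theorem stmt_14 :
    (∀ S : Multiset ℕ, Multiset.card S = 4 →
      (∀ d ∈ S, d = 1 ∨ d = 3 ∨ d = 7 ∨ d = 9) → primeArrCount 4 S ≤ 8) ∧
    primeArrCount 4 {1, 1, 3, 9} = 8 ∧ arrCount 4 {1, 1, 3, 9} = 12 ∧
    primeArrCount 4 {1, 3, 7, 9} = 7 ∧ arrCount 4 {1, 3, 7, 9} = 24 := by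
  refine ⟨?_, ?_, ?_, ?_, ?_⟩
  · intro S
    induction S using Quotient.inductionOn with
    | _ l =>
    intro hc hS
    change l.length = 4 at hc
    change ∀ d ∈ l, _ at hS
    change primeArrCount 4 (l : Multiset ℕ) ≤ 8
    rw [primeArrCount_eq l hc (fun d h => by have := hS d h; omega)]
    match l, hc with
    | [a, b, c, d], _ =>
      apply bound_all <;> simpa using hS _ (by simp)
  · exact (primeArrCount_eq [1, 1, 3, 9] rfl (by decide)).trans (by decide +kernel)
  · exact (arrCount_eq [1, 1, 3, 9] rfl (by decide)).trans (by decide +kernel)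
  · exact (primeArrCount_eq [1, 3, 7, 9] rfl (by decide)).trans (by decide +kernel)
  · exact (arrCount_eq [1, 3, 7, 9] rfl (by decide)).trans (by decide +kernel)
end

section
/- The multiset {1,1,3,7,7,9} has exactly 60 prime 6-digit arrangements among its 180 arrangements, and this is the maximum number of prime arrangements over all multisets of six digits all lying in {1, 3, 7, 9}. -/
/-- The product of all primes below 1000. -/
def primProd : ℕ := 19590340644999083431262508198206381046123972390589368223882605328968666316379870661851951648789482321596229559115436019149189529725215266728292282990852649023362731392404017939142010958261393634959471483757196721672243410067118516227661133135192488848989914892157188308679896875137439519338903968094905549750386407106033836586660683539201011635917900039904495065203299749542985993134669814805318474080581207891125910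

def genArr : ℕ → ℕ → ℕ → ℕ → ℕ → List (List ℕ)
  | 0, _, _, _, _ => [[]]
  | n + 1, a, b, c, d =>
    (match a with | 0 => [] | k + 1 => (genArr n k b c d).map (List.cons 1)) ++
    ((match b with | 0 => [] | k + 1 => (genArr n a k c d).map (List.cons 3)) ++
    ((match c with | 0 => [] | k + 1 => (genArr n a b k d).map (List.cons 7)) ++
    (match d with | 0 => [] | k + 1 => (genArr n a b c k).map (List.cons 9))))

def valArr : List ℕ → ℕ
  | [] => 0
  | d :: l => d + 10 * valArr l

def testArr (m : ℕ) : Bool := (Nat.gcd m primProd).beq 1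

def listArr (a b c d : ℕ) : List ℕ := (genArr 6 a b c d).map valArr

lemma valArr_eq (l : List ℕ) : valArr l = Nat.ofDigits 10 l := by
  induction l with
  | nil => rfl
  | cons d l ih => simp [valArr, Nat.ofDigits_cons, ih]

lemma small_dvd : ((List.range 1000).all fun p => (Nat.ble p 1) || !((Nat.gcd p primProd).beq 1)) = true := by
  decide +kernel

lemma fact_dvd : primProd ∣ Nat.factorial 999 := by
  unfold primProd
  norm_num

lemma testArr_iff {m : ℕ} (h1 : 1000 ≤ m) (h2 : m < 1000000) :
    testArr m = true ↔ Nat.Prime m := by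
  unfold testArr
  rw [Nat.beq_eq]
  constructor
  · intro h
    by_contra hp
    have hs := Nat.minFac_sq_le_self (by omega) hp
    have hlt : m.minFac < 1000 := by nlinarith
    have hpr := Nat.minFac_prime (n := m) (by omega)
    have hall := List.all_eq_true.1 small_dvd m.minFac (List.mem_range.2 hlt)
    have h2le := hpr.two_le
    simp only [Bool.or_eq_true, Nat.ble_eq, Bool.not_eq_true'] at hall
    rcases hall with hall | hall
    · omega
    · apply Nat.ne_of_beq_eq_false hall
      exact Nat.Coprime.coprime_dvd_left (Nat.minFac_dvd m) h
  · intro hp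
    refine (Nat.Prime.coprime_iff_not_dvd hp).2 fun hd => ?_
    have := (Nat.Prime.dvd_factorial hp).1 (hd.trans fact_dvd)
    omega

lemma mem_genArr (l : List ℕ) (h : ∀ x ∈ l, x = 1 ∨ x = 3 ∨ x = 7 ∨ x = 9) :
    l ∈ genArr l.length (l.count 1) (l.count 3) (l.count 7) (l.count 9) := by
  induction l with
  | nil => simp [genArr]
  | cons x l ih =>
    have ih' := ih fun y hy => h y (List.mem_cons_of_mem _ hy)
    rcases h x List.mem_cons_self with rfl | rfl | rfl | rfl <;>
      simp [genArr, ih']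

lemma count_sum (l : List ℕ) (h : ∀ x ∈ l, x = 1 ∨ x = 3 ∨ x = 7 ∨ x = 9) :
    l.count 1 + l.count 3 + l.count 7 + l.count 9 = l.length := by
  induction l with
  | nil => simp
  | cons x l ih =>
    have ih' := ih fun y hy => h y (List.mem_cons_of_mem _ hy)
    rcases h x List.mem_cons_self with rfl | rfl | rfl | rfl <;>
      simp <;> omega

lemma mem_listArr {m : ℕ} {S : Multiset ℕ} (hc : Multiset.card S = 6)
    (h : ∀ d ∈ S, d = 1 ∨ d = 3 ∨ d = 7 ∨ d = 9) (hm : (Nat.digits 10 m : Multiset ℕ) = S) :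
    m ∈ listArr (S.count 1) (S.count 3) (S.count 7) (S.count 9) := by
  subst hm
  have hl : (Nat.digits 10 m).length = 6 := by simpa using hc
  have := mem_genArr (Nat.digits 10 m) (fun x hx => h x (by simpa using hx))
  rw [hl] at this
  refine List.mem_map.2 ⟨_, by simpa using this, ?_⟩
  rw [valArr_eq, Nat.ofDigits_digits]

lemma checkAll : ((List.range 7).all fun a => (List.range 7).all fun b => (List.range 7).all fun c =>
    (List.range 7).all fun d => !(Nat.beq (a + b + c + d) 6) ||
      Nat.ble (((listArr a b c d).filter testArr).length) 60) = true := by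
  decide +kernel

lemma check_nodup : (listArr 2 1 2 1).Nodup := by decide +kernel

lemma check_length : (listArr 2 1 2 1).length = 180 := by decide +kernel

lemma check_prime : ((listArr 2 1 2 1).filter testArr).length = 60 := by decide +kernel

lemma check_perm : ∀ l ∈ genArr 6 2 1 2 1, l.Perm [1, 1, 3, 7, 7, 9] := by decide +kernel

lemma listArr_digits {m : ℕ} (hm : m ∈ listArr 2 1 2 1) :
    (Nat.digits 10 m : Multiset ℕ) = {1, 1, 3, 7, 7, 9} ∧ 100000 ≤ m ∧ m < 1000000 := by
  obtain ⟨l, hl, rfl⟩ := List.mem_map.1 hm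
  have hp := check_perm l hl
  have hmem : ∀ x ∈ l, x = 1 ∨ x = 3 ∨ x = 7 ∨ x = 9 := by
    intro x hx
    have := hp.mem_iff.1 hx
    simp at this
    omega
  have hd : Nat.digits 10 (valArr l) = l := by
    rw [valArr_eq]
    refine Nat.digits_ofDigits 10 (by norm_num) l (fun x hx => ?_) (fun hne => ?_)
    · have := hmem x hx
      omega
    · have := hmem _ (List.getLast_mem hne)
      omega
  have hlen : (Nat.digits 10 (valArr l)).length = 6 := by rw [hd, hp.length_eq]; rfl
  refine ⟨?_, ?_, ?_⟩
  · rw [hd]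
    exact Multiset.coe_eq_coe.2 hp
  · by_contra hlt
    have := (Nat.digits_length_le_iff (b := 10) (by norm_num) (k := 5) (valArr l)).2 (by omega)
    omega
  · have := (Nat.digits_length_le_iff (b := 10) (by norm_num) (k := 6) (valArr l)).1 (by omega)
    omega

lemma mem_special {m : ℕ} : m ∈ listArr 2 1 2 1 ↔
    m ∈ Finset.Ico (10 ^ (6 - 1)) (10 ^ 6) ∧
      (Nat.digits 10 m : Multiset ℕ) = {1, 1, 3, 7, 7, 9} := by
  constructor
  · intro h
    have := listArr_digits h
    refine ⟨?_, this.1⟩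
    rw [Finset.mem_Ico]
    norm_num
    exact this.2
  · rintro ⟨-, h⟩
    have := mem_listArr (m := m) (S := {1, 1, 3, 7, 7, 9}) (by decide) (by decide) h
    exact this

/-- The multiset `{1,1,3,7,7,9}` has exactly 60 prime 6-digit arrangements among
its 180 arrangements, the maximum over all multisets of six digits all lying in
{1, 3, 7, 9}. -/
theorem stmt_16 :
    primeArrCount 6 {1, 1, 3, 7, 7, 9} = 60 ∧
    arrCount 6 {1, 1, 3, 7, 7, 9} = 180 ∧
    (∀ S : Multiset ℕ, Multiset.card S = 6 →
      (∀ d ∈ S, d = 1 ∨ d = 3 ∨ d = 7 ∨ d = 9) → primeArrCount 6 S ≤ 60) := by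
  refine ⟨?_, ?_, ?_⟩
  · have : ((Finset.Ico (10 ^ (6 - 1)) (10 ^ 6)).filter
        (fun m => (Nat.digits 10 m : Multiset ℕ) = {1, 1, 3, 7, 7, 9} ∧ Nat.Prime m)) =
        ((listArr 2 1 2 1).filter testArr).toFinset := by
      ext m
      rw [List.mem_toFinset, List.mem_filter, mem_special, Finset.mem_filter, and_assoc]
      refine and_congr_right fun h1 => and_congr_right fun h2 => ?_
      rw [Finset.mem_Ico] at h1
      norm_num at h1
      exact (testArr_iff (by omega) (by omega)).symm
    rw [primeArrCount, this, List.toFinset_card_of_nodup (check_nodup.filter _), check_prime]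
  · have : ((Finset.Ico (10 ^ (6 - 1)) (10 ^ 6)).filter
        (fun m => (Nat.digits 10 m : Multiset ℕ) = {1, 1, 3, 7, 7, 9})) =
        (listArr 2 1 2 1).toFinset := by
      ext m
      rw [List.mem_toFinset, mem_special, Finset.mem_filter]
    rw [arrCount, this, List.toFinset_card_of_nodup check_nodup, check_length]
  · intro S hc hS
    have hsum : S.count 1 + S.count 3 + S.count 7 + S.count 9 = 6 := by
      induction S using Quotient.inductionOn with
      | h l =>
        have := count_sum l (fun x hx => hS x (by simpa using hx))
        simp at hc ⊢
        omega
    have hb : ((listArr (S.count 1) (S.count 3) (S.count 7) (S.count 9)).filter testArr).length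
        ≤ 60 := by
      have h1 := List.all_eq_true.1 checkAll (S.count 1) (List.mem_range.2 (by omega))
      have h2 := List.all_eq_true.1 h1 (S.count 3) (List.mem_range.2 (by omega))
      have h3 := List.all_eq_true.1 h2 (S.count 7) (List.mem_range.2 (by omega))
      have h4 := List.all_eq_true.1 h3 (S.count 9) (List.mem_range.2 (by omega))
      simp only [Bool.or_eq_true, Nat.ble_eq, Bool.not_eq_true'] at h4
      rcases h4 with h4 | h4
      · exact absurd hsum (Nat.ne_of_beq_eq_false h4)
      · exact h4
    refine le_trans ?_ hb
    refine le_trans (Finset.card_le_card (t := (List.toFinset _)) ?_) (List.toFinset_card_le _)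
    intro m hm
    rw [Finset.mem_filter, Finset.mem_Ico] at hm
    obtain ⟨h1, h2, h3⟩ := hm
    norm_num at h1
    rw [List.mem_toFinset, List.mem_filter]
    exact ⟨mem_listArr hc hS h2, (testArr_iff (by omega) (by omega)).2 h3⟩
end
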